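/- Let M ≥ 2 and H ≥ 1 be integers, let y > 0 be a real number, let p ≥ 1 be an integer, and let (S_i)_{i≥0} be a sequence of reals with S_0 = 0 and S_i ≥ ((M−1)/M)·S_{i−1} + y/M for every i ≥ 1. If S_{p−1} ≤ (1 − 1/H)·y, then p ≤ log(H)/log(M/(M−1)) + 1. -/

import Mathlib

/-- Explicit lower bound for a sequence contracting its distance to `y` by the factor `q`. -/
theorem one_sub_pow_mul_le_of_affine_rec {q y : ℝ} (hq : 0 ≤ q) {S : ℕ → ℝ} (hS0 : 0 ≤ S 0)
    (hrec : ∀ n, q * S n + (1 - q) * y ≤ S (n + 1)) (n : ℕ) :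
    (1 - q ^ n) * y ≤ S n := by
  induction n with
  | zero => simpa using hS0
  | succ k ih =>
    calc (1 - q ^ (k + 1)) * y = q * ((1 - q ^ k) * y) + (1 - q) * y := by ring
      _ ≤ q * S k + (1 - q) * y := by gcongr
      _ ≤ S (k + 1) := hrec k

/-- Bound on the number of triggering rounds within a stage: if `S 0 = 0`,
`S i ≥ ((M−1)/M)·S (i−1) + y/M` for `i ≥ 1`, and `S (p−1) ≤ (1 − 1/H)·y`,
then `p ≤ log H / log(M/(M−1)) + 1`. -/
theorem stmt_12 (M H : ℕ) (hM : 2 ≤ M) (hH : 1 ≤ H) (y : ℝ) (hy : 0 < y)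
    (p : ℕ) (hp : 1 ≤ p) (S : ℕ → ℝ)
    (hS0 : S 0 = 0)
    (hrec : ∀ i, 1 ≤ i → ((M : ℝ) - 1) / M * S (i - 1) + y / M ≤ S i)
    (hSp : S (p - 1) ≤ (1 - 1 / (H : ℝ)) * y) :
    (p : ℝ) ≤ Real.log H / Real.log ((M : ℝ) / ((M : ℝ) - 1)) + 1 := by
  obtain ⟨n, rfl⟩ := Nat.exists_eq_add_of_le' hp
  have hM' : (2 : ℝ) ≤ M := by exact_mod_cast hM
  have hH' : (0 : ℝ) < H := by exact_mod_cast hH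
  have hM0 : (0 : ℝ) < M := by linarith
  have hM1 : (0 : ℝ) < (M : ℝ) - 1 := by linarith
  have hlow : (1 - (((M : ℝ) - 1) / M) ^ n) * y ≤ S n := by
    refine one_sub_pow_mul_le_of_affine_rec (by positivity) hS0.ge (fun k => ?_) n
    have hk := hrec (k + 1) (by omega)
    rw [Nat.add_sub_cancel] at hk
    have hcoef : (1 - ((M : ℝ) - 1) / M) * y = y / M := by field_simp; ring
    rwa [hcoef]
  have hinv : 1 / (H : ℝ) ≤ (((M : ℝ) - 1) / M) ^ n := by
    have := le_of_mul_le_mul_right (hlow.trans hSp) hy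
    linarith
  have hpow : ((M : ℝ) / ((M : ℝ) - 1)) ^ n ≤ H := by
    have := inv_anti₀ (by positivity) hinv
    rwa [← inv_pow, inv_div, one_div, inv_inv] at this
  have hlog : 0 < Real.log ((M : ℝ) / ((M : ℝ) - 1)) :=
    Real.log_pos ((one_lt_div hM1).2 (by linarith))
  push_cast
  gcongr
  rw [le_div_iff₀ hlog, ← Real.log_pow]
  exact Real.log_le_log (by positivity) hpow
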